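/- Let k be an even positive integer and suppose f : ℍ → ℂ satisfies f|_k T = f, f|_k H₁₁ = ε f for some ε ∈ {1,-1}, f|_k W₁₁ = f, f|_k T₂ = c₂ f and f|_k T₄ = c₄ f for some c₂, c₄ ∈ ℂ. Then (f − f|_k([[4,-1],[-11,3]]))|_k β(1/4) + (f − f|_k([[4,1],[11,3]]))|_k β(−1/4) = 0. -/

import Mathlib

open Complex UpperHalfPlane Matrix

/-- Möbius transform of `z ∈ ℍ` under a real 2×2 matrix, as a complex number. -/
noncomputable def moebius (γ : Matrix (Fin 2) (Fin 2) ℝ) (z : ℍ) : ℂ :=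
  ((γ 0 0 : ℂ) * (z : ℂ) + (γ 0 1 : ℂ)) / ((γ 1 0 : ℂ) * (z : ℂ) + (γ 1 1 : ℂ))

/-- Action of a real 2×2 matrix on the upper half-plane.  When the matrix has
positive determinant the Möbius image lies in `ℍ` and the `dite` takes the
first branch, so this agrees with the usual fractional linear action. -/
noncomputable def act (γ : Matrix (Fin 2) (Fin 2) ℝ) (z : ℍ) : ℍ :=
  if h : 0 < (moebius γ z).im then ⟨moebius γ z, h⟩ else z

/-- Weight-`k` slash action `f ∣[k] γ` with the classical normalization
`(det γ)^(k/2) (cz+d)^(-k) f(γz)` (for `k` even, `det γ > 0`). -/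
noncomputable def slash (k : ℤ) (γ : Matrix (Fin 2) (Fin 2) ℝ) (f : ℍ → ℂ) : ℍ → ℂ :=
  fun z => ((γ.det : ℂ) ^ (k / 2)) * (((γ 1 0 : ℂ) * (z : ℂ) + (γ 1 1 : ℂ)) ^ (-k)) * f (act γ z)

/-- The Hecke operator `T_n` (trivial character):
`f ∣[k] T_n = Σ_{ad = n, a,d > 0, 0 ≤ b < d} f ∣[k] [[a,b],[0,d]]`. -/
noncomputable def hecke (k : ℤ) (n : ℕ) (f : ℍ → ℂ) : ℍ → ℂ :=
  fun z => ∑ a ∈ n.divisors, ∑ b ∈ Finset.range (n / a),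
    slash k !![(a : ℝ), (b : ℝ); 0, ((n / a : ℕ) : ℝ)] f z

/-- The matrix `T = [[1,1],[0,1]]`. -/
noncomputable def Tmat : Matrix (Fin 2) (Fin 2) ℝ := !![1, 1; 0, 1]

/-- The Fricke matrix `H_N = [[0,-1],[N,0]]`. -/
noncomputable def Hmat (N : ℕ) : Matrix (Fin 2) (Fin 2) ℝ := !![0, -1; (N : ℝ), 0]

/-- The matrix `W_N = [[1,0],[N,1]]`. -/
noncomputable def Wmat (N : ℕ) : Matrix (Fin 2) (Fin 2) ℝ := !![1, 0; (N : ℝ), 1]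

/-- The matrix `β(x) = [[1,x],[0,1]]`. -/
noncomputable def betaMat (x : ℝ) : Matrix (Fin 2) (Fin 2) ℝ := !![1, x; 0, 1]

theorem denom_ne_zero_of_det_pos {γ : Matrix (Fin 2) (Fin 2) ℝ} (hγ : 0 < γ.det) (z : ℍ) :
    (γ 1 0 : ℂ) * (z : ℂ) + (γ 1 1 : ℂ) ≠ 0 := by
  intro h
  have him := congrArg Complex.im h
  have hre := congrArg Complex.re h
  simp only [Complex.add_im, Complex.add_re, Complex.mul_im, Complex.mul_re, Complex.ofReal_re,
    Complex.ofReal_im, zero_mul, add_zero, sub_zero, Complex.zero_im, Complex.zero_re] at him hre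
  have h10 : γ 1 0 = 0 := (mul_eq_zero.mp him).resolve_right z.im_pos.ne'
  have h11 : γ 1 1 = 0 := by simpa [h10] using hre
  rw [Matrix.det_fin_two, h10, h11] at hγ
  simp at hγ

theorem moebius_im_pos {γ : Matrix (Fin 2) (Fin 2) ℝ} (hγ : 0 < γ.det) (z : ℍ) :
    0 < (moebius γ z).im := by
  have hd := Complex.normSq_pos.mpr (denom_ne_zero_of_det_pos hγ z)
  have him : (moebius γ z).im = γ.det * (z : ℂ).im /
      Complex.normSq ((γ 1 0 : ℂ) * (z : ℂ) + (γ 1 1 : ℂ)) := by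
    rw [moebius, Complex.div_im, Matrix.det_fin_two, ← sub_div]
    congr 1
    simp
    ring
  rw [him]
  exact div_pos (mul_pos hγ z.im_pos) hd

theorem coe_act {γ : Matrix (Fin 2) (Fin 2) ℝ} (hγ : 0 < γ.det) (z : ℍ) :
    (act γ z : ℂ) = moebius γ z := by
  rw [act, dif_pos (moebius_im_pos hγ z)]

theorem denom_mul {γ δ : Matrix (Fin 2) (Fin 2) ℝ} (hδ : 0 < δ.det) (z : ℍ) :
    ((γ * δ) 1 0 : ℂ) * (z : ℂ) + ((γ * δ) 1 1 : ℂ) =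
      ((γ 1 0 : ℂ) * (act δ z : ℂ) + (γ 1 1 : ℂ)) * ((δ 1 0 : ℂ) * (z : ℂ) + (δ 1 1 : ℂ)) := by
  have h := denom_ne_zero_of_det_pos hδ z
  rw [coe_act hδ, moebius, Matrix.mul_apply, Matrix.mul_apply]
  simp only [Fin.sum_univ_two]
  push_cast
  field_simp
  ring

theorem act_mul {γ δ : Matrix (Fin 2) (Fin 2) ℝ} (hγ : 0 < γ.det) (hδ : 0 < δ.det) (z : ℍ) :
    act (γ * δ) z = act γ (act δ z) := by
  have hγδ : 0 < (γ * δ).det := by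
    rw [Matrix.det_mul]
    exact mul_pos hγ hδ
  apply UpperHalfPlane.ext
  have h := denom_ne_zero_of_det_pos hδ z
  rw [coe_act hγδ, coe_act hγ, moebius, moebius, denom_mul hδ,
    div_eq_div_iff (mul_ne_zero (denom_ne_zero_of_det_pos hγ _) h)
      (denom_ne_zero_of_det_pos hγ _)]
  have hnum : ((γ * δ) 0 0 : ℂ) * (z : ℂ) + ((γ * δ) 0 1 : ℂ) =
      ((γ 0 0 : ℂ) * (act δ z : ℂ) + (γ 0 1 : ℂ)) *
        ((δ 1 0 : ℂ) * (z : ℂ) + (δ 1 1 : ℂ)) := by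
    rw [coe_act hδ, moebius, Matrix.mul_apply, Matrix.mul_apply]
    simp only [Fin.sum_univ_two]
    push_cast
    field_simp
    ring
  rw [hnum]
  ring

theorem slash_mul (k : ℤ) {γ δ : Matrix (Fin 2) (Fin 2) ℝ} (hγ : 0 < γ.det) (hδ : 0 < δ.det)
    (f : ℍ → ℂ) : slash k (γ * δ) f = slash k δ (slash k γ f) := by
  funext z
  simp only [slash]
  rw [denom_mul hδ, act_mul hγ hδ, Matrix.det_mul, Complex.ofReal_mul, mul_zpow, mul_zpow]
  ring

theorem act_smul {c : ℝ} (hc : c ≠ 0) (γ : Matrix (Fin 2) (Fin 2) ℝ) (z : ℍ) :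
    act (c • γ) z = act γ z := by
  have h : moebius (c • γ) z = moebius γ z := by
    have hc' : (c : ℂ) ≠ 0 := Complex.ofReal_ne_zero.mpr hc
    simp only [moebius, Matrix.smul_apply, smul_eq_mul, Complex.ofReal_mul, mul_assoc,
      ← mul_add]
    exact mul_div_mul_left _ _ hc'
  simp only [act, h]

theorem slash_smul_matrix {k : ℤ} (hk : Even k) {c : ℝ} (hc : c ≠ 0)
    (γ : Matrix (Fin 2) (Fin 2) ℝ) (f : ℍ → ℂ) : slash k (c • γ) f = slash k γ f := by
  have hc' : (c : ℂ) ≠ 0 := Complex.ofReal_ne_zero.mpr hc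
  obtain ⟨m, rfl⟩ := hk
  have hm : (m + m) / 2 = m := by omega
  funext z
  simp only [slash]
  rw [act_smul hc, Matrix.det_smul, hm]
  simp only [Matrix.smul_apply, smul_eq_mul, Complex.ofReal_mul, Complex.ofReal_pow, mul_assoc,
    ← mul_add, mul_zpow, Fintype.card_fin]
  have hcancel : ((c : ℂ) ^ 2) ^ m * (c : ℂ) ^ (-(m + m)) = 1 := by
    rw [← zpow_natCast, ← _root_.zpow_mul, ← zpow_add₀ hc']
    convert zpow_zero (c : ℂ) using 2
    push_cast
    ring
  linear_combination
    ((γ.det : ℂ) ^ m * ((γ 1 0 : ℂ) * (z : ℂ) + (γ 1 1 : ℂ)) ^ (-(m + m)) * f (act γ z)) * hcancel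

/-- The slash action only sees a product of matrices up to a nonzero scalar. -/
theorem slash_slash_eq {k : ℤ} (hk : Even k) {γ δ η : Matrix (Fin 2) (Fin 2) ℝ} {c : ℝ}
    (hc : c ≠ 0) (hγ : 0 < γ.det) (hδ : 0 < δ.det) (h : γ * δ = c • η) (f : ℍ → ℂ) :
    slash k δ (slash k γ f) = slash k η f := by
  rw [← slash_mul k hγ hδ, h, slash_smul_matrix hk hc]

theorem slash_add (k : ℤ) (γ : Matrix (Fin 2) (Fin 2) ℝ) (f g : ℍ → ℂ) :
    slash k γ (f + g) = slash k γ f + slash k γ g := by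
  funext z
  simp only [slash, Pi.add_apply]
  ring

theorem slash_sub (k : ℤ) (γ : Matrix (Fin 2) (Fin 2) ℝ) (f g : ℍ → ℂ) :
    slash k γ (f - g) = slash k γ f - slash k γ g := by
  funext z
  simp only [slash, Pi.sub_apply]
  ring

theorem slash_smul (k : ℤ) (γ : Matrix (Fin 2) (Fin 2) ℝ) (c : ℂ) (f : ℍ → ℂ) :
    slash k γ (c • f) = c • slash k γ f := by
  funext z
  simp only [slash, Pi.smul_apply, smul_eq_mul]
  ring

/-- Conjugation by the Fricke matrix turns upper triangular matrices into lower triangular ones. -/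
theorem slash_Hmat_slash_upper {k : ℤ} {N : ℕ} (hN : 0 < N) {f : ℍ → ℂ} {ε : ℂ}
    (hH : slash k (Hmat N) f = ε • f) {a b d : ℝ} (had : 0 < a * d) :
    slash k (Hmat N) (slash k !![a, b; 0, d] f) = ε • slash k !![d, 0; -(N * b), a] f := by
  have hHdet : 0 < (Hmat N).det := by simpa [Hmat, Matrix.det_fin_two] using hN
  have hcomm : !![a, b; 0, d] * Hmat N = Hmat N * !![d, 0; -(N * b), a] := by
    ext i j
    fin_cases i <;> fin_cases j <;> simp [Hmat, Matrix.mul_apply, Fin.sum_univ_two] <;> ring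
  rw [← slash_smul, ← hH, ← slash_mul k _ hHdet, ← slash_mul k hHdet, hcomm]
  · simpa [Matrix.det_fin_two, mul_comm] using had
  · simpa [Matrix.det_fin_two] using had

theorem hecke_two (k : ℤ) (f : ℍ → ℂ) :
    hecke k 2 f = slash k !![1, 0; 0, 2] f + slash k !![1, 1; 0, 2] f +
      slash k !![2, 0; 0, 1] f := by
  funext z
  have hdiv : Nat.divisors 2 = {1, 2} := by decide
  simp [hecke, hdiv, Finset.sum_range_succ]

theorem hecke_four (k : ℤ) (f : ℍ → ℂ) :
    hecke k 4 f = slash k !![1, 0; 0, 4] f + slash k !![1, 1; 0, 4] f +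
      slash k !![1, 2; 0, 4] f + slash k !![1, 3; 0, 4] f +
      (slash k !![2, 0; 0, 2] f + slash k !![2, 1; 0, 2] f) + slash k !![4, 0; 0, 1] f := by
  funext z
  have hdiv : Nat.divisors 4 = {1, 2, 4} := by decide
  simp [hecke, hdiv, Finset.sum_range_succ, add_assoc]

/-- A Fricke eigenfunction that is an eigenfunction of an operator is one of its Fricke conjugate,
with the same eigenvalue. -/
theorem eq_of_slash_Hmat_eq {k : ℤ} {N : ℕ} {f g g' : ℍ → ℂ} {ε c : ℂ}
    (hε : ε = 1 ∨ ε = -1) (hH : slash k (Hmat N) f = ε • f) (hg : g = c • f)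
    (hg' : slash k (Hmat N) g = ε • g') : g = g' := by
  have hε0 : ε ≠ 0 := by rcases hε with rfl | rfl <;> simp
  rw [hg, slash_smul, hH, smul_comm] at hg'
  rw [hg]
  exact smul_right_injective _ hε0 hg'

/-- The term of `T_2` that Fricke symmetry does not match with another one equals its conjugate. -/
theorem slash_half_eq {k : ℤ} {f : ℍ → ℂ} {ε c : ℂ} (hε : ε = 1 ∨ ε = -1)
    (hH : slash k (Hmat 11) f = ε • f) (h2 : hecke k 2 f = c • f) :
    slash k !![1, 1; 0, 2] f = slash k !![2, 0; -11, 1] f := by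
  rw [hecke_two] at h2
  have h := eq_of_slash_Hmat_eq hε hH h2
    (g' := slash k !![2, 0; 0, 1] f + slash k !![2, 0; -11, 1] f + slash k !![1, 0; 0, 2] f) (by
      rw [slash_add, slash_add]
      rw [slash_Hmat_slash_upper (by norm_num) hH (by norm_num),
        slash_Hmat_slash_upper (by norm_num) hH (by norm_num),
        slash_Hmat_slash_upper (by norm_num) hH (by norm_num)]
      simp [smul_add])
  linear_combination h

theorem slash_quarter_add_eq {k : ℤ} (hk : Even k) {f : ℍ → ℂ} {ε c₂ c₄ : ℂ}
    (hε : ε = 1 ∨ ε = -1) (hT : slash k Tmat f = f) (hH : slash k (Hmat 11) f = ε • f)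
    (h2 : hecke k 2 f = c₂ • f) (h4 : hecke k 4 f = c₄ • f) :
    slash k !![1, 1; 0, 4] f + slash k !![1, -1; 0, 4] f =
      slash k !![4, 0; -11, 1] f + slash k !![4, 0; 11, 1] f := by
  have hX := slash_half_eq hε hH h2
  have hshift : slash k !![1, 3; 0, 4] f = slash k !![1, -1; 0, 4] f := by
    conv_rhs => rw [← hT]
    refine (slash_slash_eq hk one_ne_zero ?_ ?_ ?_ f).symm
    · simp [Tmat]
    · simp
    · norm_num [Tmat]
  have upper : ∀ a d : ℝ, 0 < a * d →
      slash k !![a, 0; 0, d] (slash k !![1, 1; 0, 2] f) = slash k !![a, d; 0, 2 * d] f := by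
    intro a d had
    refine slash_slash_eq hk one_ne_zero ?_ ?_ ?_ f
    · simp
    · simpa using had
    · simp
  have lower : ∀ a d : ℝ, 0 < a * d →
      slash k !![a, 0; 0, d] (slash k !![2, 0; -11, 1] f) =
        slash k !![2 * a, 0; -(11 * a), d] f := by
    intro a d had
    refine slash_slash_eq hk one_ne_zero ?_ ?_ ?_ f
    · simp
    · simpa using had
    · simp
  rw [hecke_four, hshift] at h4
  have h := eq_of_slash_Hmat_eq hε hH h4
    (g' := slash k !![4, 0; 0, 1] f + slash k !![4, 0; -11, 1] f +
      slash k !![4, 0; -22, 1] f + slash k !![4, 0; 11, 1] f +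
      (slash k !![2, 0; 0, 2] f + slash k !![2, 0; -11, 2] f) + slash k !![1, 0; 0, 4] f) (by
      simp only [slash_add]
      rw [slash_Hmat_slash_upper (by norm_num) hH (by norm_num),
        slash_Hmat_slash_upper (by norm_num) hH (by norm_num),
        slash_Hmat_slash_upper (by norm_num) hH (by norm_num),
        slash_Hmat_slash_upper (by norm_num) hH (by norm_num),
        slash_Hmat_slash_upper (by norm_num) hH (by norm_num),
        slash_Hmat_slash_upper (by norm_num) hH (by norm_num),
        slash_Hmat_slash_upper (by norm_num) hH (by norm_num)]
      norm_num [smul_add])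
  have u1 := upper 1 2 (by norm_num)
  have u2 := upper 2 1 (by norm_num)
  have l1 := lower 1 2 (by norm_num)
  have l2 := lower 2 1 (by norm_num)
  rw [hX] at u1 u2
  norm_num at u1 u2 l1 l2
  linear_combination h + u1 + u2 - l1 - l2

theorem T4_relation_level_11 (k : ℤ) (hk : 0 < k) (hke : Even k) (f : ℍ → ℂ)
    (ε : ℂ) (hε : ε = 1 ∨ ε = -1) (c₂ c₄ : ℂ)
    (hT : slash k Tmat f = f) (hH : slash k (Hmat 11) f = ε • f)
    (hW : slash k (Wmat 11) f = f)
    (h2 : hecke k 2 f = c₂ • f) (h4 : hecke k 4 f = c₄ • f) :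
    slash k (betaMat (1 / 4)) (f - slash k !![(4 : ℝ), -1; -11, 3] f)
      + slash k (betaMat (-(1 / 4))) (f - slash k !![(4 : ℝ), 1; 11, 3] f) = 0 := by
  have hq := congrArg (slash k !![4, 0; 0, 1]) (slash_quarter_add_eq hke hε hT hH h2 h4)
  rw [slash_add, slash_add] at hq
  have combine : ∀ {γ η : Matrix (Fin 2) (Fin 2) ℝ}, 0 < γ.det →
      γ * !![4, 0; 0, 1] = (4 : ℝ) • η → slash k !![4, 0; 0, 1] (slash k γ f) = slash k η f :=
    fun hγ h => slash_slash_eq hke four_ne_zero hγ (by simp) h f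
  have e1 : slash k !![4, 0; 0, 1] (slash k !![1, 1; 0, 4] f) = slash k (betaMat (1 / 4)) f :=
    combine (by simp) (by norm_num [betaMat])
  have e2 : slash k !![4, 0; 0, 1] (slash k !![1, -1; 0, 4] f) =
      slash k (betaMat (-(1 / 4))) f :=
    combine (by simp) (by norm_num [betaMat])
  have e3 : slash k !![4, 0; 0, 1] (slash k !![4, 0; -11, 1] f) =
      slash k !![4, 0; -11, 1 / 4] f :=
    combine (by simp) (by norm_num)
  have e4 : slash k !![4, 0; 0, 1] (slash k !![4, 0; 11, 1] f) = slash k !![4, 0; 11, 1 / 4] f :=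
    combine (by simp) (by norm_num)
  have e5 : slash k (betaMat (1 / 4)) (slash k !![4, -1; -11, 3] f) =
      slash k !![4, 0; -11, 1 / 4] f :=
    slash_slash_eq hke one_ne_zero (by norm_num [Matrix.det_fin_two]) (by simp [betaMat])
      (by norm_num [betaMat]) f
  have e6 : slash k (betaMat (-(1 / 4))) (slash k !![4, 1; 11, 3] f) =
      slash k !![4, 0; 11, 1 / 4] f :=
    slash_slash_eq hke one_ne_zero (by norm_num [Matrix.det_fin_two]) (by simp [betaMat])
      (by norm_num [betaMat]) f
  rw [slash_sub, slash_sub, e5, e6]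
  rw [e1, e2, e3, e4] at hq
  linear_combination hq
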